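/- Let p ≥ 2 and G_{p,p} = ⟨x, y | x^p = y^p⟩, and let ψ be the automorphism with ψ(x) = y⁻¹, ψ(y) = x⁻¹ (i.e. ψ = σ∘τ). If ι_g ∘ ψ has finite order in Aut(G_{p,p}) (equivalently g·ψ(g) ∈ Z(G_{p,p})), then the fixed subgroup of ι_g ∘ ψ is trivial: the only h ∈ G_{p,p} with (ι_g ∘ ψ)(h) = h is h = 1. -/

import Mathlib

/-- The torus knot group `⟨x, y | x^p = y^q⟩`, as the presented group obtained as the
quotient of the free group on two generators by the normal closure of `a^p * b^(-q)`. -/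
def TKG (p q : ℕ) : Type :=
  PresentedGroup ({FreeGroup.of true ^ p * (FreeGroup.of false ^ q)⁻¹} : Set (FreeGroup Bool))

instance TKG.instGroup (p q : ℕ) : Group (TKG p q) := by
  delta TKG; infer_instance

/-- The generator `x` of the torus knot group. -/
def TKx (p q : ℕ) : TKG p q := PresentedGroup.of true

/-- The generator `y` of the torus knot group. -/
def TKy (p q : ℕ) : TKG p q := PresentedGroup.of false

open Monoid Monoid.CoprodI

section Aux

variable {C : Type} [CommGroup C]

/-- The free product of two copies of `C`. -/
abbrev FP (C : Type) [CommGroup C] : Type := CoprodI (fun _ : Bool => C)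

/-- The letter `m` in the factor `i`. -/
abbrev lt (i : Bool) (m : C) : FP C := CoprodI.of (M := fun _ : Bool => C) (i := i) m

/-- The swap-and-invert endomorphism. -/
def psi : FP C →* FP C :=
  CoprodI.lift fun i => (CoprodI.of (M := fun _ : Bool => C) (i := !i)).comp (invMonoidHom : C →* C)

theorem psi_lt (i : Bool) (m : C) : psi (lt i m) = lt (!i) m⁻¹ := by
  simp [psi, lt]

open scoped Classical in
/-- Length of the normal form. -/
noncomputable def len (w : FP C) : ℕ := (Word.equiv w).toList.length

open scoped Classical in
theorem len_mul_le (i : Bool) (m : C) (x : FP C) : len (lt i m * x) ≤ len x + 1 := by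
  have hr : ∀ q : Word.Pair (fun _ : Bool => C) i,
      (Word.rcons q).toList.length ≤ q.tail.toList.length + 1 ∧
      q.tail.toList.length ≤ (Word.rcons q).toList.length := by
    intro q
    unfold Word.rcons
    split_ifs <;> simp [Word.cons]
  have h1 : Word.equiv (lt i m * x) = lt i m • Word.equiv x := by
    simp [Word.equiv, mul_smul]
  have h2 := (hr (Word.equivPair i (Word.equiv x))).2
  rw [← Word.equivPair_symm, Equiv.symm_apply_apply] at h2
  unfold len
  rw [h1, Word.of_smul_def]
  refine (hr _).1.trans ?_
  simpa using h2

theorem len_list (L : List (Σ _ : Bool, C)) :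
    len ((L.map fun l => lt l.1 l.2).prod) ≤ L.length := by
  induction L with
  | nil => simp [len, Word.equiv, Word.empty]
  | cons a L ih =>
    simp only [List.map_cons, List.prod_cons, List.length_cons]
    exact (len_mul_le _ _ _).trans (by omega)

open scoped Classical in
theorem exists_neWord (g : FP C) (hg : g ≠ 1) :
    ∃ (i j : Bool) (w : NeWord (fun _ : Bool => C) i j), w.prod = g ∧ w.toList.length = len g := by
  obtain ⟨i, j, w, hw⟩ := NeWord.of_word (Word.equiv g) (by
    intro h
    apply hg
    have := congrArg Word.equiv.symm h
    rw [Equiv.symm_apply_apply] at this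
    rw [this]
    exact Word.prod_empty)
  refine ⟨i, j, w, ?_, ?_⟩
  · rw [NeWord.prod, hw]
    exact Word.equiv.symm_apply_apply g
  · rw [len, ← hw]; rfl

open scoped Classical in
theorem toList_eq {i j k l : Bool} (w : NeWord (fun _ : Bool => C) i j)
    (w' : NeWord (fun _ : Bool => C) k l) (h : w.prod = w'.prod) : w.toList = w'.toList := by
  have : w.toWord = w'.toWord := Word.equiv.symm.injective h
  exact congrArg Word.toList this

theorem exists_psi {i j : Bool} (w : NeWord (fun _ : Bool => C) i j) :
    ∃ w' : NeWord (fun _ : Bool => C) (!i) (!j), w'.prod = psi w.prod ∧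
      w'.toList.length = w.toList.length := by
  induction w with
  | @singleton i x hx =>
    refine ⟨NeWord.singleton x⁻¹ (by simpa using hx), ?_, rfl⟩
    rw [NeWord.prod_singleton, NeWord.prod_singleton]
    exact (psi_lt i x).symm
  | append w₁ hne w₂ ih₁ ih₂ =>
    obtain ⟨a, ha, ha'⟩ := ih₁
    obtain ⟨b, hb, hb'⟩ := ih₂
    refine ⟨NeWord.append a (by simpa using hne) b, ?_, ?_⟩
    · simp [ha, hb]
    · simp [ha', hb']

/-- The twisted conjugation map. -/
def Phi (g : FP C) (w : FP C) : FP C := g * psi w * g⁻¹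

theorem grow {i : Bool} (v : NeWord (fun _ : Bool => C) i i) (n : ℕ) :
    ∃ w : NeWord (fun _ : Bool => C) i i, w.prod = (Phi v.prod)^[n] v.prod ∧
      n + v.toList.length ≤ w.toList.length := by
  induction n with
  | zero => exact ⟨v, rfl, by simp⟩
  | succ n ih =>
    obtain ⟨w, hw, hl⟩ := ih
    obtain ⟨w', hw', hl'⟩ := exists_psi w
    have hv : 0 < v.toList.length := List.length_pos_iff.2 v.toList_ne_nil
    refine ⟨(v.append (by simp) w').append (by simp) v.inv, ?_, ?_⟩
    · rw [Function.iterate_succ_apply', ← hw]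
      simp [Phi, hw']
    · simp only [NeWord.toList, List.length_append]
      omega

theorem Phi_semiconj (g u : FP C) :
    Function.Semiconj (fun w => u⁻¹ * w * u) (Phi g) (Phi (u⁻¹ * g * psi u)) := by
  intro w
  simp only [Phi, map_mul, map_inv]
  group

theorem fix_FP (n : ℕ) : ∀ (g : FP C) (_ : len g = n) (k : ℕ) (_ : 0 < k)
    (_ : ∀ w, (Phi g)^[k] w = w) (h : FP C) (_ : Phi g h = h), h = 1 := by
  induction n using Nat.strong_induction_on with
  | _ n ih =>
  intro g hn k hk hfin h hh
  by_cases hg : g = 1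
  · by_contra hne
    obtain ⟨i, j, w, hw, -⟩ := exists_neWord h hne
    obtain ⟨w', hw', -⟩ := exists_psi w
    have h1 : w'.prod = w.prod := by
      rw [hw', hw]; simpa [Phi, hg] using hh
    have h2 := congrArg List.head? (toList_eq _ _ h1)
    rw [NeWord.toList_head?, NeWord.toList_head?] at h2
    have h3 := congrArg Sigma.fst (Option.some.inj h2)
    simp at h3
  · obtain ⟨i, j, w, hw, hl⟩ := exists_neWord g hg
    by_cases hij : j = i
    · subst hij
      obtain ⟨w', hw', hl'⟩ := grow w k
      rw [hw, hfin, ← hw] at hw'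
      rw [toList_eq _ _ hw'] at hl'
      omega
    · obtain rfl : j = !i := by cases i <;> cases j <;> simp_all
      have hhd := w.toList_head?
      have hlast := w.toList_getLast?
      have hprod : g = (w.toList.map fun l => lt l.1 l.2).prod := by rw [← hw]; rfl
      generalize w.toList = L at *
      generalize w.head = m at *
      generalize w.last = s at *
      obtain ⟨L', rfl⟩ : ∃ L', L = ⟨i, m⟩ :: L' := by
        cases L with
        | nil => simp at hhd
        | cons a L => exact ⟨L, by simpa using hhd⟩
      obtain ⟨L'', rfl⟩ : ∃ L'', L' = L'' ++ [⟨!i, s⟩] := by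
        rcases List.eq_nil_or_concat' L' with rfl | ⟨L'', b, rfl⟩
        · exfalso
          have h3 := congrArg Sigma.fst (Option.some.inj hlast)
          simp at h3
        · refine ⟨L'', ?_⟩
          rw [← List.cons_append, List.getLast?_append] at hlast
          simp at hlast
          rw [hlast]
      have hg' : (lt i m)⁻¹ * g * psi (lt i m) =
          ((L'' ++ [(⟨!i, s * m⁻¹⟩ : Σ _ : Bool, C)]).map fun l : (Σ _ : Bool, C) => lt l.1 l.2).prod := by
        rw [psi_lt, hprod]
        simp only [List.map_cons, List.prod_cons, List.map_append, List.prod_append, List.map_nil,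
          List.prod_nil, mul_one, lt, map_mul]
        group
      have hsc := Phi_semiconj g (lt i m)
      have key := ih (len ((lt i m)⁻¹ * g * psi (lt i m))) (by
        rw [hg']
        refine (len_list _).trans_lt ?_
        simp at hl ⊢
        omega) _ rfl k hk (by
          intro w
          have := (hsc.iterate_right k).eq (lt i m * w * (lt i m)⁻¹)
          rw [hfin] at this
          simpa [mul_assoc] using this.symm) ((lt i m)⁻¹ * h * lt i m) (by
            have := hsc.eq h
            rw [hh] at this
            exact this.symm)
      have : h = lt i m * ((lt i m)⁻¹ * h * lt i m) * (lt i m)⁻¹ := by group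
      rw [this, key]
      group

end Aux

section TK

variable {p : ℕ} {H : Type} [Group H]

theorem TK_rel (p : ℕ) : TKx p p ^ p = TKy p p ^ p := by
  have : PresentedGroup.mk ({FreeGroup.of true ^ p * (FreeGroup.of false ^ p)⁻¹} :
      Set (FreeGroup Bool)) (FreeGroup.of true ^ p * (FreeGroup.of false ^ p)⁻¹) = 1 :=
    (QuotientGroup.eq_one_iff _).2 (Subgroup.subset_normalClosure rfl)
  rw [map_mul, map_inv, map_pow, map_pow, mul_inv_eq_one] at this
  exact this

/-- The universal property. -/
def TKlift (p : ℕ) (a b : H) (h : a ^ p = b ^ p) : TKG p p →* H :=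
  PresentedGroup.toGroup (f := fun c : Bool => if c then a else b)
    (rels := {FreeGroup.of true ^ p * (FreeGroup.of false ^ p)⁻¹}) (by
      intro r hr
      rw [Set.mem_singleton_iff] at hr
      subst hr
      simp [h])

theorem TKlift_x (a b : H) (h : a ^ p = b ^ p) : TKlift p a b h (TKx p p) = a :=
  PresentedGroup.toGroup.of (f := fun c : Bool => if c then a else b) (x := true) _

theorem TKlift_y (a b : H) (h : a ^ p = b ^ p) : TKlift p a b h (TKy p p) = b :=
  PresentedGroup.toGroup.of (f := fun c : Bool => if c then a else b) (x := false) _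

theorem TK_ext {f g : TKG p p →* H} (hx : f (TKx p p) = g (TKx p p))
    (hy : f (TKy p p) = g (TKy p p)) : f = g :=
  PresentedGroup.ext (rels := {FreeGroup.of true ^ p * (FreeGroup.of false ^ p)⁻¹})
    (φ := f) (ψ := g) (by
      intro c
      cases c
      · exact hy
      · exact hx)

theorem TK_central (p : ℕ) (h : TKG p p) : TKx p p ^ p * h = h * TKx p p ^ p := by
  have : (MulAut.conj (TKx p p ^ p)).toMonoidHom = MonoidHom.id (TKG p p) := by
    apply TK_ext
    · change TKx p p ^ p * TKx p p * (TKx p p ^ p)⁻¹ = TKx p p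
      group
    · rw [TK_rel]
      change TKy p p ^ p * TKy p p * (TKy p p ^ p)⁻¹ = TKy p p
      group
  have := DFunLike.congr_fun this h
  change TKx p p ^ p * h * (TKx p p ^ p)⁻¹ = h at this
  rw [mul_inv_eq_iff_eq_mul] at this
  exact this

theorem exists_zmod_hom (p : ℕ) (q : H) (hq : q ^ p = 1) :
    ∃ f : Multiplicative (ZMod p) →* H, f (Multiplicative.ofAdd 1) = q := by
  refine ⟨AddMonoidHom.toMultiplicativeLeft (ZMod.lift p ⟨zmultiplesHom (Additive H) (Additive.ofMul q), ?_⟩), ?_⟩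
  · simp [← ofMul_pow, hq]
  · have := ZMod.lift_coe p ⟨zmultiplesHom (Additive H) (Additive.ofMul q),
      by simp [← ofMul_pow, hq]⟩ 1
    simp at this
    simp [this]

theorem gen_pow (p : ℕ) (i : Bool) :
    lt i (Multiplicative.ofAdd (1 : ZMod p)) ^ p = 1 := by
  rw [← map_pow, ← ofAdd_nsmul]
  simp

/-- Projection to the free product. -/
def proj (p : ℕ) : TKG p p →* FP (Multiplicative (ZMod p)) :=
  TKlift p (lt true (Multiplicative.ofAdd 1)) (lt false (Multiplicative.ofAdd 1))
    (by rw [gen_pow, gen_pow])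

theorem proj_ker (h : TKG p p) (hh : proj p h = 1) : ∃ n : ℤ, (TKx p p ^ p) ^ n = h := by
  have hN : (Subgroup.zpowers (TKx p p ^ p)).Normal := by
    constructor
    rintro _ ⟨n, rfl⟩ g
    have : Commute (TKx p p ^ p) g := TK_central p g
    refine ⟨n, ?_⟩
    have h2 := (this.zpow_left n).eq
    simp only [← h2]
    group
  let mk := QuotientGroup.mk' (Subgroup.zpowers (TKx p p ^ p))
  have hx : mk (TKx p p) ^ p = 1 := by
    rw [← map_pow]
    exact (QuotientGroup.eq_one_iff _).2 (Subgroup.mem_zpowers _)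
  have hy : mk (TKy p p) ^ p = 1 := by
    rw [← map_pow, ← TK_rel]
    exact (QuotientGroup.eq_one_iff _).2 (Subgroup.mem_zpowers _)
  obtain ⟨fx, hfx⟩ := exists_zmod_hom p _ hx
  obtain ⟨fy, hfy⟩ := exists_zmod_hom p _ hy
  let F : FP (Multiplicative (ZMod p)) →* _ := CoprodI.lift fun i => if i then fx else fy
  have hF : F.comp (proj p) = mk := by
    apply TK_ext
    · rw [MonoidHom.comp_apply, proj, TKlift_x, ← hfx]
      simp [F, lt]
    · rw [MonoidHom.comp_apply, proj, TKlift_y, ← hfy]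
      simp [F, lt]
  have : mk h = 1 := by rw [← hF, MonoidHom.comp_apply, hh, map_one]
  exact (QuotientGroup.eq_one_iff _).1 this

theorem proj_surj (p : ℕ) : Function.Surjective (proj p) := by
  intro w
  induction w using CoprodI.induction_on with
  | one => exact ⟨1, map_one _⟩
  | of i m =>
    obtain ⟨n, hn⟩ := ZMod.intCast_surjective (Multiplicative.toAdd m)
    have hm : m = (Multiplicative.ofAdd (1 : ZMod p)) ^ n := by
      rw [← ofAdd_zsmul]
      simp [hn]
    cases i
    · refine ⟨TKy p p ^ n, ?_⟩
      rw [map_zpow, proj, TKlift_y, hm, map_zpow]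
    · refine ⟨TKx p p ^ n, ?_⟩
      rw [map_zpow, proj, TKlift_x, hm, map_zpow]
  | mul a b ha hb =>
    obtain ⟨a, rfl⟩ := ha
    obtain ⟨b, rfl⟩ := hb
    exact ⟨a * b, map_mul _ _ _⟩

/-- The degree map. -/
def deg (p : ℕ) : TKG p p →* Multiplicative ℤ :=
  TKlift p (Multiplicative.ofAdd 1) (Multiplicative.ofAdd 1) rfl

end TK

/-- If `ι_g ∘ ψ` has finite order, where `ψ = σ∘τ : x ↦ y⁻¹, y ↦ x⁻¹`, then the fixed
subgroup of `ι_g ∘ ψ` is trivial. -/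
theorem TKG_fix_sigma_tau_g_finite_order (p : ℕ) (hp : 2 ≤ p)
    (ψ : MulAut (TKG p p))
    (hψx : ψ (TKx p p) = (TKy p p)⁻¹) (hψy : ψ (TKy p p) = (TKx p p)⁻¹)
    (g : TKG p p) (hfin : IsOfFinOrder (MulAut.conj g * ψ)) :
    ∀ h : TKG p p, (MulAut.conj g * ψ) h = h → h = 1 := by
  have hx : proj p (TKx p p) = lt true (Multiplicative.ofAdd 1) := TKlift_x _ _ _
  have hy : proj p (TKy p p) = lt false (Multiplicative.ofAdd 1) := TKlift_y _ _ _
  have hdx : deg p (TKx p p) = Multiplicative.ofAdd 1 := TKlift_x _ _ _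
  have hdy : deg p (TKy p p) = Multiplicative.ofAdd 1 := TKlift_y _ _ _
  have h1 : (proj p).comp ψ.toMonoidHom = psi.comp (proj p) := by
    apply TK_ext
    · change proj p (ψ (TKx p p)) = psi (proj p (TKx p p))
      rw [hψx, hx, psi_lt, map_inv, hy]
      exact (map_inv _ _).symm
    · change proj p (ψ (TKy p p)) = psi (proj p (TKy p p))
      rw [hψy, hy, psi_lt, map_inv, hx]
      exact (map_inv _ _).symm
  have h2 : (deg p).comp ψ.toMonoidHom = (invMonoidHom).comp (deg p) := by
    apply TK_ext
    · change deg p (ψ (TKx p p)) = (deg p (TKx p p))⁻¹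
      rw [hψx, map_inv, hdx, hdy]
    · change deg p (ψ (TKy p p)) = (deg p (TKy p p))⁻¹
      rw [hψy, map_inv, hdx, hdy]
  have hsc : Function.Semiconj (proj p) (fun w => (MulAut.conj g * ψ) w) (Phi (proj p g)) := by
    intro w
    have := DFunLike.congr_fun h1 w
    change proj p (ψ w) = psi (proj p w) at this
    simp [Phi, this]
  intro h hh
  obtain ⟨k, hk, hk1⟩ := isOfFinOrder_iff_pow_eq_one.1 hfin
  have hone : proj p h = 1 := by
    refine fix_FP _ (proj p g) rfl k hk ?_ _ ?_
    · intro w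
      obtain ⟨w, rfl⟩ := proj_surj p w
      rw [← (hsc.iterate_right k).eq w]
      congr 1
      have := DFunLike.congr_fun hk1 w
      change _ = w at this
      conv_rhs => rw [← this]
      clear this hk1 hk
      induction k with
      | zero => rfl
      | succ k ih => rw [Function.iterate_succ_apply', ih, pow_succ']; rfl
    · rw [← hsc.eq h, hh]
  obtain ⟨n, rfl⟩ := proj_ker h hone
  have h3 := congrArg (deg p) hh
  have h4 := DFunLike.congr_fun h2 ((TKx p p ^ p) ^ n)
  change deg p (ψ _) = (deg p _)⁻¹ at h4
  rw [MulAut.mul_apply, MulAut.conj_apply, map_mul, map_mul, h4, map_inv] at h3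
  simp only [map_zpow, map_pow, hdx] at h3
  have h5 := congrArg Multiplicative.toAdd h3
  simp at h5
  have h6 : n = 0 := by
    have : (n : ℤ) * p = 0 := by linarith
    rcases mul_eq_zero.1 this with h | h
    · exact h
    · omega
  rw [h6, zpow_zero]
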